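/- Let I be a finite nonempty monotonic set of intervals with pairwise distinct finishing times, let m be the ≼-least interval of I, and let J be the greedy optimal set of I. Then for every i ∈ I: i ∈ J if and only if i = m, or there exists an interval x on the ancestor chain of m in the linearised tree L(I) with (x, i) ∈ E_c (equivalently, i lies on the ancestor chain of m and the chain enters i along a compatible edge). -/

import Mathlib

/-- Two intervals (given as pairs (start, finish)) are compatible if one
finishes strictly before the other starts. -/
def Compatible (i j : ℝ × ℝ) : Prop := i.2 < j.1 ∨ j.2 < i.1

/-- `j` is the right compatible interval of `i` in `I`: the ≼-least element of
`I` compatible with `i` and strictly after `i` in the ordering by finishing time. -/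
def IsRC (I : Finset (ℝ × ℝ)) (i j : ℝ × ℝ) : Prop :=
  j ∈ I ∧ i.2 < j.2 ∧ Compatible i j ∧
    ∀ k ∈ I, i.2 < k.2 → Compatible i k → j.2 ≤ k.2

/-- A set of intervals is monotonic if no interval properly contains another. -/
def Monotonic (I : Finset (ℝ × ℝ)) : Prop :=
  ∀ i ∈ I, ∀ j ∈ I, i ≠ j → ¬(i.1 ≤ j.1 ∧ j.2 ≤ i.2)

/-- Equivalence edge of the linearised tree: `i ∼ j` (same right compatible
interval) and `i` is the ≼-predecessor of `j` in `I`. -/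
def ESim (I : Finset (ℝ × ℝ)) (i j : ℝ × ℝ) : Prop :=
  i ∈ I ∧ j ∈ I ∧ (∃ r, IsRC I i r ∧ IsRC I j r) ∧
    i.2 < j.2 ∧ ∀ k ∈ I, i.2 < k.2 → j.2 ≤ k.2

/-- Compatibility edge of the linearised tree: `rc(i)` exists, `i` is the
≼-greatest element of its equivalence class `[i]`, and `j = rc(i)`. -/
def EC (I : Finset (ℝ × ℝ)) (i j : ℝ × ℝ) : Prop :=
  i ∈ I ∧ IsRC I i j ∧ ∀ k ∈ I, IsRC I k j → k.2 ≤ i.2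

/-- An edge of the linearised tree `L(I)` (union of the two edge sets). -/
def LTEdge (I : Finset (ℝ × ℝ)) (i j : ℝ × ℝ) : Prop :=
  ESim I i j ∨ EC I i j

/-- `m` is the ≼-least interval of `I` (ordering by finishing time). -/
def IsLeastInterval (I : Finset (ℝ × ℝ)) (m : ℝ × ℝ) : Prop :=
  m ∈ I ∧ ∀ j ∈ I, m.2 ≤ j.2

/-- Membership in the greedy optimal set of `I`. -/
inductive InGreedy (I : Finset (ℝ × ℝ)) : ℝ × ℝ → Prop
  | base (m : ℝ × ℝ) : IsLeastInterval I m → InGreedy I m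
  | step (i j : ℝ × ℝ) : InGreedy I i → IsRC I i j → InGreedy I j

/-- `x` lies on the ancestor chain of `m` in the linearised tree `L(I)`:
`x` is `m` or an iterated parent of `m`. -/
def OnAncestorChain (I : Finset (ℝ × ℝ)) (m x : ℝ × ℝ) : Prop :=
  Relation.ReflTransGen (LTEdge I) m x

theorem Compatible.finish_lt_start {i k : ℝ × ℝ} (hi : i.1 < i.2) (hik : i.2 < k.2)
    (h : Compatible i k) : i.2 < k.1 :=
  h.resolve_right fun h' => by linarith

theorem IsRC.unique {I : Finset (ℝ × ℝ)} (hdist : ∀ i ∈ I, ∀ j ∈ I, i.2 = j.2 → i = j)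
    {i r r' : ℝ × ℝ} (h : IsRC I i r) (h' : IsRC I i r') : r = r' :=
  hdist r h.1 r' h'.1 <|
    le_antisymm (h.2.2.2 r' h'.1 h'.2.1 h'.2.2.1) (h'.2.2.2 r h.1 h.2.1 h.2.2.1)

/-- The intervals with a given right compatible interval are convex for `≼`. -/
theorem IsRC.of_between {I : Finset (ℝ × ℝ)} (hval : ∀ i ∈ I, i.1 < i.2) {i j k r : ℝ × ℝ}
    (hj : j ∈ I) (hk : k ∈ I) (hir : IsRC I i r) (hjr : IsRC I j r)
    (hik : i.2 ≤ k.2) (hkj : k.2 ≤ j.2) : IsRC I k r := by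
  have hjs := hjr.2.2.1.finish_lt_start (hval j hj) hjr.2.1
  refine ⟨hir.1, hkj.trans_lt hjr.2.1, Or.inl (hkj.trans_lt hjs), fun l hl hkl hc => ?_⟩
  have hks := hc.finish_lt_start (hval k hk) hkl
  exact hir.2.2.2 l hl (hik.trans_lt hkl) (Or.inl (hik.trans_lt hks))

/-- Equivalence edges lead from `i` to the greatest element of its class. -/
theorem IsRC.exists_onAncestorChain_EC {I : Finset (ℝ × ℝ)} (hval : ∀ i ∈ I, i.1 < i.2)
    {i j : ℝ × ℝ} (hi : i ∈ I) (hij : IsRC I i j) :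
    ∃ x, OnAncestorChain I i x ∧ EC I x j := by
  induction hn : (I.filter fun k => i.2 < k.2).card using Nat.strong_induction_on
    generalizing i with
  | _ n ih =>
    by_cases hmax : ∀ k ∈ I, IsRC I k j → k.2 ≤ i.2
    · exact ⟨i, Relation.ReflTransGen.refl, hi, hij, hmax⟩
    push Not at hmax
    obtain ⟨k, hk, hkj, hik⟩ := hmax
    obtain ⟨s, hs, hmin⟩ := Finset.exists_min_image (I.filter fun k => i.2 < k.2) Prod.snd
      ⟨k, Finset.mem_filter.2 ⟨hk, hik⟩⟩
    obtain ⟨hsI, his⟩ := Finset.mem_filter.1 hs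
    have hsk := hmin k (Finset.mem_filter.2 ⟨hk, hik⟩)
    have hsj : IsRC I s j := hij.of_between hval hk hsI hkj his.le hsk
    have hlt : (I.filter fun k => s.2 < k.2).card < n := by
      rw [← hn]
      refine Finset.card_lt_card ((Finset.ssubset_iff_of_subset fun l hl => ?_).2
        ⟨s, hs, fun h => lt_irrefl _ (Finset.mem_filter.1 h).2⟩)
      obtain ⟨hlI, hsl⟩ := Finset.mem_filter.1 hl
      exact Finset.mem_filter.2 ⟨hlI, his.trans hsl⟩
    obtain ⟨x, hx, hxj⟩ := ih _ hlt hsI hsj rfl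
    refine ⟨x, Relation.ReflTransGen.head (Or.inl ?_) hx, hxj⟩
    exact ⟨hi, hsI, ⟨j, hij, hsj⟩, his,
      fun l hl hil => hmin l (Finset.mem_filter.2 ⟨hl, hil⟩)⟩

theorem InGreedy.mem {I : Finset (ℝ × ℝ)} {i : ℝ × ℝ} (h : InGreedy I i) : i ∈ I := by
  cases h with
  | base _ h => exact h.1
  | step _ _ _ h => exact h.1

/-- Every right compatible interval of a node on the chain is one of a greedy interval. -/
theorem OnAncestorChain.exists_inGreedy {I : Finset (ℝ × ℝ)}
    (hdist : ∀ i ∈ I, ∀ j ∈ I, i.2 = j.2 → i = j) {m x : ℝ × ℝ}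
    (hm : IsLeastInterval I m) (hx : OnAncestorChain I m x) :
    ∃ g, InGreedy I g ∧ ∀ r, IsRC I x r → IsRC I g r := by
  induction hx with
  | refl => exact ⟨m, .base m hm, fun _ h => h⟩
  | @tail x y _ hxy ih =>
    obtain ⟨g, hg, hgr⟩ := ih
    rcases hxy with ⟨_, _, ⟨r, hxr, hyr⟩, _⟩ | ⟨_, hxy, _⟩
    · exact ⟨g, hg, fun r' hr' => hgr r' (hyr.unique hdist hr' ▸ hxr)⟩
    · exact ⟨y, .step g y hg (hgr y hxy), fun _ h => h⟩

/-- For a nonempty monotonic set `I` with ≼-least interval `m`: an interval `i`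
belongs to the greedy optimal set if and only if `i = m` or some interval `x`
on the ancestor chain of `m` in the linearised tree `L(I)` has a compatibility
edge `(x, i) ∈ E_c`. -/
theorem greedy_iff_ancestor_chain_compatible_edge (I : Finset (ℝ × ℝ))
    (hne : I.Nonempty)
    (hval : ∀ i ∈ I, i.1 < i.2)
    (hdist : ∀ i ∈ I, ∀ j ∈ I, i.2 = j.2 → i = j)
    (hmono : Monotonic I)
    (m : ℝ × ℝ) (hm : IsLeastInterval I m) :
    ∀ i ∈ I, (InGreedy I i ↔
      i = m ∨ ∃ x : ℝ × ℝ, OnAncestorChain I m x ∧ EC I x i) := by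
  refine fun i _ => ⟨fun h => ?_, ?_⟩
  · induction h with
    | base m' hm' =>
      exact Or.inl (hdist m' hm'.1 m hm.1 (le_antisymm (hm'.2 m hm.1) (hm.2 m' hm'.1)))
    | step i j hgi hij ih =>
      have hchain : OnAncestorChain I m i := by
        rcases ih hgi.mem with rfl | ⟨x, hx, hxi⟩
        · exact Relation.ReflTransGen.refl
        · exact Relation.ReflTransGen.tail hx (Or.inr hxi)
      obtain ⟨x, hx, hxj⟩ := hij.exists_onAncestorChain_EC hval hgi.mem
      exact Or.inr ⟨x, Relation.ReflTransGen.trans hchain hx, hxj⟩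
  · rintro (rfl | ⟨x, hx, hxi⟩)
    · exact .base i hm
    · obtain ⟨g, hg, hgr⟩ := hx.exists_inGreedy hdist hm
      exact .step g i hg (hgr i hxi.2.1)
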